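/- arXiv:2311.18240 — 2 statements merged into one kernel-verified Lean document; each statement's English description precedes it below -/
import Mathlib

section
/- Let Φ : alg(M′, M) → alg(M′, M) be a linear map. Then Φ = φ̃ for some linear map φ : M → M (i.e. Φ(A′B) = A′φ(B) for all A′ ∈ M′, B ∈ M) if and only if Φ is an M′-bimodule map, that is, Φ(A′ X B′) = A′ Φ(X) B′ for all A′, B′ ∈ M′ and X ∈ alg(M′, M). -/
set_option synthInstance.maxHeartbeats 1000000
set_option maxHeartbeats 1000000

noncomputable section

open scoped InnerProductSpace ComplexOrder
open ContinuousLinearMap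

local notation "⟪" x ", " y "⟫" => @inner ℂ _ _ x y

namespace ChoiInf

variable {H : Type*} [NormedAddCommGroup H] [InnerProductSpace ℂ H] [CompleteSpace H]

/-- The rank one operator `x ⊠ y : z ↦ (z|y)·x = ⟪y, z⟫ • x`
(inner products written with Mathlib's convention: conjugate linear in the
first variable, so that the paper's `(z|y)` is `⟪y, z⟫`). -/
def rankOne (x y : H) : H →L[ℂ] H := (innerSL ℂ y).smulRight x

/-- The trace of an operator, computed relative to a Hilbert basis:
`Tr X = Σᵢ (X eᵢ | eᵢ) = Σᵢ ⟪eᵢ, X eᵢ⟫`.  (For trace class operators this does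
not depend on the choice of basis.) -/
def tr {ι : Type*} (b : HilbertBasis ι ℂ H) (T : H →L[ℂ] H) : ℂ :=
  ∑' i, ⟪b i, T (b i)⟫

/-- The bilinear pairing `⟨A, B⟩ = Tr (A B)` between `B(H)` and `T(H)`. -/
def pairing {ι : Type*} (b : HilbertBasis ι ℂ H) (A T : H →L[ℂ] H) : ℂ :=
  tr b (A ∘L T)

/-- Trace class operators, characterized by nuclear representations
`T = Σₙ xₙ ⊠ yₙ` with `Σₙ ‖xₙ‖‖yₙ‖ < ∞`. -/
def IsTraceClass (T : H →L[ℂ] H) : Prop :=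
  ∃ x y : ℕ → H, Summable (fun n => ‖x n‖ * ‖y n‖) ∧
    ∀ z, T z = ∑' n, ⟪y n, z⟫ • x n

/-- The trace norm, as the infimum of `Σₙ ‖xₙ‖‖yₙ‖` over all nuclear
representations `T = Σₙ xₙ ⊠ yₙ`. -/
def traceNorm (T : H →L[ℂ] H) : ℝ :=
  sInf {c : ℝ | ∃ x y : ℕ → H, HasSum (fun n => ‖x n‖ * ‖y n‖) c ∧
    ∀ z, T z = ∑' n, ⟪y n, z⟫ • x n}

/-- `(Φ, Φst)` is a dual pair:  `Φst` preserves the trace class and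
`⟨Φ A, T⟩ = ⟨A, Φst T⟩` for all trace class `T`.  A linear map `Φ` on `B(H)` is
normal (σ-weakly continuous) precisely when it admits such a predual map `Φst`. -/
def IsNormalPair {ι : Type*} (b : HilbertBasis ι ℂ H)
    (Φ Φst : (H →L[ℂ] H) →ₗ[ℂ] (H →L[ℂ] H)) : Prop :=
  (∀ T, IsTraceClass T → IsTraceClass (Φst T)) ∧
    ∀ A T, IsTraceClass T → pairing b (Φ A) T = pairing b A (Φst T)

/-- Positivity of a `k × k` matrix of operators, i.e. positivity of the
corresponding operator on `H ⊕ ⋯ ⊕ H`. -/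
def MatPos {k : ℕ} (A : Fin k → Fin k → (H →L[ℂ] H)) : Prop :=
  ∀ v : Fin k → H, 0 ≤ ∑ i, ∑ j, ⟪v i, A i j (v j)⟫

/-- The operator on `H ⊕ ⋯ ⊕ H` given by a `k × k` matrix of operators has norm `≤ c`. -/
def matNormLe {k : ℕ} (A : Fin k → Fin k → (H →L[ℂ] H)) (c : ℝ) : Prop :=
  ∀ v w : Fin k → H,
    ‖∑ i, ∑ j, ⟪w i, A i j (v j)⟫‖ ≤
      c * Real.sqrt (∑ i, ‖v i‖ ^ 2) * Real.sqrt (∑ i, ‖w i‖ ^ 2)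

/-- A von Neumann algebra is a factor when its center consists of the scalars. -/
def IsFactor (M : VonNeumannAlgebra H) : Prop :=
  ∀ T ∈ M, T ∈ M.commutant → ∃ c : ℂ, T = c • (1 : H →L[ℂ] H)

/-- `x0` is a cyclic vector for `M`. -/
def Cyclic (M : VonNeumannAlgebra H) (x0 : H) : Prop :=
  Dense {y : H | ∃ A ∈ M, A x0 = y}

/-- `x0` is a separating vector for `M`. -/
def Separating (M : VonNeumannAlgebra H) (x0 : H) : Prop :=
  ∀ A ∈ M, A x0 = 0 → A = 0

/-- `Φ` restricts on `alg(M', M)` to the map `φ̃ : A'B ↦ A'·φ(B)`.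
(Maps `φ : M → M` are encoded as linear maps on `B(H)` sending `M` into `M`;
only the restriction to `M` is relevant.) -/
def ExtendsTilde (M : VonNeumannAlgebra H)
    (φ Φ : (H →L[ℂ] H) →ₗ[ℂ] (H →L[ℂ] H)) : Prop :=
  ∀ A' ∈ M.commutant, ∀ B ∈ M, Φ (A' * B) = A' * φ B

/-- The space `CB^σ_ε(M)` of maps `φ : M → M` such that `φ̃` extends to a normal
map on `B(H)`. -/
def CBSigmaE {ι : Type*} (b : HilbertBasis ι ℂ H) (M : VonNeumannAlgebra H) :
    Set ((H →L[ℂ] H) →ₗ[ℂ] (H →L[ℂ] H)) :=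
  {φ | (∀ B ∈ M, φ B ∈ M) ∧
    ∃ Φ Φst, ExtendsTilde M φ Φ ∧ IsNormalPair b Φ Φst}

/-- `φ` is completely positive as a map on `M`. -/
def IsCPOn (M : VonNeumannAlgebra H) (φ : (H →L[ℂ] H) →ₗ[ℂ] (H →L[ℂ] H)) : Prop :=
  ∀ (k : ℕ) (A : Fin k → Fin k → (H →L[ℂ] H)), (∀ i j, A i j ∈ M) →
    MatPos A → MatPos fun i j => φ (A i j)

/-- `φ` is completely positive (on all of `B(H)`). -/
def IsCPFull (φ : (H →L[ℂ] H) →ₗ[ℂ] (H →L[ℂ] H)) : Prop :=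
  ∀ (k : ℕ) (A : Fin k → Fin k → (H →L[ℂ] H)), MatPos A → MatPos fun i j => φ (A i j)

/-- `c` is a completely bounded bound for `φ` as a map on `M`. -/
def CBBoundOn (M : VonNeumannAlgebra H) (φ : (H →L[ℂ] H) →ₗ[ℂ] (H →L[ℂ] H))
    (c : ℝ) : Prop :=
  ∀ (k : ℕ) (A : Fin k → Fin k → (H →L[ℂ] H)), (∀ i j, A i j ∈ M) →
    matNormLe A 1 → matNormLe (fun i j => φ (A i j)) c

/-- The completely bounded norm of `φ` as a map on `M`. -/
def cbNormOn (M : VonNeumannAlgebra H) (φ : (H →L[ℂ] H) →ₗ[ℂ] (H →L[ℂ] H)) : ℝ :=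
  sInf {c : ℝ | 0 ≤ c ∧ CBBoundOn M φ c}

/-- `φ` is completely bounded as a map on `M`. -/
def IsCBOn (M : VonNeumannAlgebra H) (φ : (H →L[ℂ] H) →ₗ[ℂ] (H →L[ℂ] H)) : Prop :=
  ∃ c, 0 ≤ c ∧ CBBoundOn M φ c

/-- `φ` is normal as a map on `M`: every normal functional composed with `φ`
is again normal (i.e. implemented by a trace class operator). -/
def NormalOn {ι : Type*} (b : HilbertBasis ι ℂ H) (M : VonNeumannAlgebra H)
    (φ : (H →L[ℂ] H) →ₗ[ℂ] (H →L[ℂ] H)) : Prop :=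
  ∀ T, IsTraceClass T → ∃ T', IsTraceClass T' ∧
    ∀ A ∈ M, pairing b (φ A) T = pairing b A T'

/-- The map `Ad_V : X ↦ V* X V`. -/
def AdL (V : H →L[ℂ] H) : (H →L[ℂ] H) →ₗ[ℂ] (H →L[ℂ] H) where
  toFun X := star V * X * V
  map_add' X Y := by simp [add_mul, mul_add]
  map_smul' c X := by simp [smul_mul_assoc, mul_smul_comm]

/-- `p` is a minimal (nonzero) projection in `M`. -/
def IsMinimalProjection (M : VonNeumannAlgebra H) (p : H →L[ℂ] H) : Prop :=
  p ∈ M ∧ IsIdempotentElem p ∧ IsSelfAdjoint p ∧ p ≠ 0 ∧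
    ∀ q, q ∈ M → IsIdempotentElem q → IsSelfAdjoint q → q ≠ 0 →
      q * p = q → p * q = q → q = p

/-- A factor is of type I precisely when it contains a minimal projection. -/
def IsTypeI (M : VonNeumannAlgebra H) : Prop :=
  ∃ p, IsMinimalProjection M p




variable {K : Type*} [NormedAddCommGroup K] [InnerProductSpace ℂ K] [CompleteSpace K]

/-- `T` is a Hilbert–Schmidt operator (relative to a Hilbert basis `e`;
this does not depend on the choice of `e`). -/
def IsHS {ι : Type*} (e : HilbertBasis ι ℂ K) (T : K →L[ℂ] K) : Prop :=
  Summable fun i => ‖T (e i)‖ ^ 2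

/-- A model of the Hilbert space `HS(K)` of Hilbert–Schmidt operators on `K`,
with `B(K)` acting by left multiplications `Lmul` and right multiplications
`Rmul`.  `toOp` regards a vector of `H` as an operator on `K`; its range is
exactly the set of Hilbert–Schmidt operators, and the inner product of `H` is
`(x|y) = Tr (x y*)`, i.e. `⟪x, y⟫ = Σᵢ ⟪x eᵢ, y eᵢ⟫`. -/
structure HSModel {ι : Type*} (e : HilbertBasis ι ℂ K) (H : Type*)
    [NormedAddCommGroup H] [InnerProductSpace ℂ H] [CompleteSpace H] where
  toOp : H →ₗ[ℂ] (K →L[ℂ] K)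
  inj : Function.Injective toOp
  mem_range : ∀ T : K →L[ℂ] K, IsHS e T ↔ ∃ x : H, toOp x = T
  inner_eq : ∀ x y : H, ⟪x, y⟫ = ∑' i, ⟪toOp x (e i), toOp y (e i)⟫
  Lmul : (K →L[ℂ] K) → (H →L[ℂ] H)
  Lmul_eq : ∀ a x, toOp (Lmul a x) = a ∘L toOp x
  Rmul : (K →L[ℂ] K) → (H →L[ℂ] H)
  Rmul_eq : ∀ a x, toOp (Rmul a x) = toOp x ∘L a

/-- The operator `T` has rank at most `k`. -/
def rankLE (T : K →L[ℂ] K) (k : ℕ) : Prop :=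
  Module.rank ℂ (LinearMap.range (T : K →ₗ[ℂ] K)) ≤ (k : Cardinal)

variable {H : Type*} [NormedAddCommGroup H] [InnerProductSpace ℂ H] [CompleteSpace H]
  {ι : Type*} {e : HilbertBasis ι ℂ K}

/-- `Φ` restricts to the map `φ̃ : R_y L_x ↦ R_y L_{φ(x)}` on `alg(M', M)` for
`M = L_{B(K)}`. -/
def HSExt (m : HSModel e H) (φ : (K →L[ℂ] K) →ₗ[ℂ] (K →L[ℂ] K))
    (Φ : (H →L[ℂ] H) →ₗ[ℂ] (H →L[ℂ] H)) : Prop :=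
  ∀ a x : K →L[ℂ] K, Φ (m.Rmul a ∘L m.Lmul x) = m.Rmul a ∘L m.Lmul (φ x)

/-- `φ` is `k`-positive. -/
def kPos (k : ℕ) (φ : (K →L[ℂ] K) →ₗ[ℂ] (K →L[ℂ] K)) : Prop :=
  ∀ A : Fin k → Fin k → (K →L[ℂ] K), MatPos A → MatPos fun i j => φ (A i j)

/-- `φ` is completely bounded (as a map on all of `B(K)`). -/
def IsCBFullK (φ : (K →L[ℂ] K) →ₗ[ℂ] (K →L[ℂ] K)) : Prop :=
  ∃ c, 0 ≤ c ∧ ∀ (k : ℕ) (A : Fin k → Fin k → (K →L[ℂ] K)),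
    matNormLe A 1 → matNormLe (fun i j => φ (A i j)) c

/-- `φ` belongs to `CB^σ(B(K))`: it is normal and completely bounded. -/
def NormalCB (e : HilbertBasis ι ℂ K) (φ : (K →L[ℂ] K) →ₗ[ℂ] (K →L[ℂ] K)) : Prop :=
  (∃ φst, IsNormalPair e φ φst) ∧ IsCBFullK φ

/-- The cone `𝒮_k` of `T(H)`: the trace-norm closed convex cone generated by
the `ω_{x,x} = x ⊠ x` with `rank x ≤ k` (rank as an operator on `K`). -/
def SchmidtCone (m : HSModel e H) (k : ℕ) : Set (H →L[ℂ] H) :=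
  {T | ∀ ε : ℝ, 0 < ε → ∃ (n : ℕ) (x : Fin n → H),
    (∀ i, rankLE (m.toOp (x i)) k) ∧
      traceNorm (T - ∑ i, rankOne (x i) (x i)) < ε}

/-- `ψ` belongs to the convex cone `𝔼_k` generated by the maps `Ad_V` with
`rank V ≤ k`. -/
def InEk (k : ℕ) (ψ : (K →L[ℂ] K) →ₗ[ℂ] (K →L[ℂ] K)) : Prop :=
  ∃ (n : ℕ) (V : Fin n → (K →L[ℂ] K)), (∀ i, rankLE (V i) k) ∧
    ∀ x, ψ x = ∑ i, star (V i) * x * V i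

/-- `φ` (with Choi trace-class operator `Dphi = D_φ`) is `k`-superpositive:
it lies in the `‖·‖_D`-closure of the cone `𝔼_k`, where `‖ψ‖_D = ‖D_ψ‖_{T(H)}`. -/
def kSuper {ιH : Type*} (bH : HilbertBasis ιH ℂ H) (m : HSModel e H) (x0 : H)
    (k : ℕ) (Dphi : H →L[ℂ] H) : Prop :=
  ∀ ε : ℝ, 0 < ε → ∃ ψ Ψ Ψst, InEk k ψ ∧ HSExt m ψ Ψ ∧ IsNormalPair bH Ψ Ψst ∧
    traceNorm (Dphi - Ψst (rankOne x0 x0)) < ε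


/-- The algebra generated by the commutant and the algebra is spanned by the products `A' * B`. -/
lemma adjoin_commutant_union_le_span {H : Type*} [NormedAddCommGroup H] [InnerProductSpace ℂ H]
    [CompleteSpace H] (M : VonNeumannAlgebra H) :
    Subalgebra.toSubmodule (Algebra.adjoin ℂ
        ((M.commutant : Set (H →L[ℂ] H)) ∪ (M : Set (H →L[ℂ] H)))) ≤
      Submodule.span ℂ {T | ∃ A' ∈ M.commutant, ∃ B ∈ M, A' * B = T} := by
  rw [Algebra.adjoin_eq_span, Submodule.span_le]
  intro T hT
  refine Submodule.subset_span ?_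
  induction hT using Submonoid.closure_induction with
  | mem x hx =>
    rcases hx with hx | hx
    · exact ⟨x, hx, 1, one_mem M, mul_one x⟩
    · exact ⟨1, one_mem M.commutant, x, hx, one_mul x⟩
  | one => exact ⟨1, one_mem M.commutant, 1, one_mem M, one_mul 1⟩
  | mul x y _ _ hx hy =>
    obtain ⟨A, hA, B, hB, rfl⟩ := hx
    obtain ⟨C, hC, D, hD, rfl⟩ := hy
    refine ⟨A * C, mul_mem hA hC, B * D, mul_mem hB hD, ?_⟩
    have h : B * C = C * B := VonNeumannAlgebra.mem_commutant_iff.mp hC B hB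
    simp only [mul_assoc]
    rw [← mul_assoc C B D, ← h, mul_assoc]

/-- Linear combinations of products `A' * B` lie in the algebra generated by the commutant and
the algebra. -/
lemma span_le_adjoin_commutant_union {H : Type*} [NormedAddCommGroup H] [InnerProductSpace ℂ H]
    [CompleteSpace H] (M : VonNeumannAlgebra H) :
    Submodule.span ℂ {T | ∃ A' ∈ M.commutant, ∃ B ∈ M, A' * B = T} ≤
      Subalgebra.toSubmodule (Algebra.adjoin ℂ
        ((M.commutant : Set (H →L[ℂ] H)) ∪ (M : Set (H →L[ℂ] H)))) := by
  rw [Submodule.span_le]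
  rintro _ ⟨A, hA, B, hB, rfl⟩
  exact Subalgebra.mul_mem _ (Algebra.subset_adjoin (Set.mem_union_left _ hA))
    (Algebra.subset_adjoin (Set.mem_union_right _ hB))

/-- Proposition 2.1.  Let `Φ` be a linear map on
`alg(M', M)`.  Then `Φ = φ̃` for some linear map `φ : M → M` (i.e.
`Φ(A'B) = A'·φ(B)` for all `A' ∈ M'`, `B ∈ M`) if and only if `Φ` is an
`M'`-bimodule map. -/
theorem statement0
    {H : Type*} [NormedAddCommGroup H] [InnerProductSpace ℂ H] [CompleteSpace H]
    [TopologicalSpace.SeparableSpace H]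
    (M : VonNeumannAlgebra H) (hfactor : IsFactor M)
    (x0 : H) (hx0 : ‖x0‖ = 1) (hcyc : Cyclic M x0) (hsep : Separating M x0)
    (Φ : ↥(Algebra.adjoin ℂ ((M.commutant : Set (H →L[ℂ] H)) ∪ (M : Set (H →L[ℂ] H)))) →ₗ[ℂ]
        ↥(Algebra.adjoin ℂ ((M.commutant : Set (H →L[ℂ] H)) ∪ (M : Set (H →L[ℂ] H))))) :
    (∃ (φ : (H →L[ℂ] H) →ₗ[ℂ] (H →L[ℂ] H)) (hφ : ∀ B ∈ M, φ B ∈ M),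
      ∀ (A' : H →L[ℂ] H) (hA' : A' ∈ M.commutant) (B : H →L[ℂ] H) (hB : B ∈ M),
        Φ ⟨A' * B, mul_mem (Algebra.subset_adjoin (Set.mem_union_left _ hA'))
            (Algebra.subset_adjoin (Set.mem_union_right _ hB))⟩ =
          ⟨A' * φ B, mul_mem (Algebra.subset_adjoin (Set.mem_union_left _ hA'))
            (Algebra.subset_adjoin (Set.mem_union_right _ (hφ B hB)))⟩) ↔
    (∀ (A' : H →L[ℂ] H) (hA' : A' ∈ M.commutant) (B' : H →L[ℂ] H) (hB' : B' ∈ M.commutant)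
        (X : ↥(Algebra.adjoin ℂ ((M.commutant : Set (H →L[ℂ] H)) ∪ (M : Set (H →L[ℂ] H))))),
      Φ (⟨A', Algebra.subset_adjoin (Set.mem_union_left _ hA')⟩ * X *
          ⟨B', Algebra.subset_adjoin (Set.mem_union_left _ hB')⟩) =
        ⟨A', Algebra.subset_adjoin (Set.mem_union_left _ hA')⟩ * Φ X *
          ⟨B', Algebra.subset_adjoin (Set.mem_union_left _ hB')⟩) := by
  constructor
  · rintro ⟨φ, hφ, h⟩ A hA B hB ⟨X, hX⟩
    have hspan := adjoin_commutant_union_le_span M hX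
    induction hspan using Submodule.span_induction with
    | mem X hX' =>
      obtain ⟨C, hC, D, hD, rfl⟩ := hX'
      have hcomm {T : H →L[ℂ] H} (hT : T ∈ M) : A * (C * T) * B = A * C * B * T := by
        simp only [mul_assoc]
        rw [VonNeumannAlgebra.mem_commutant_iff.mp hB T hT]
      rw [h C hC D hD]
      calc _ = Φ ⟨A * C * B * D, mul_mem
              (Algebra.subset_adjoin (Set.mem_union_left _ (mul_mem (mul_mem hA hC) hB)))
              (Algebra.subset_adjoin (Set.mem_union_right _ hD))⟩ :=
            congrArg Φ (Subtype.ext (hcomm hD))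
        _ = _ := (h _ (mul_mem (mul_mem hA hC) hB) D hD).trans
            (Subtype.ext (hcomm (hφ D hD)).symm)
    | zero =>
      have h0 : (⟨0, hX⟩ : Algebra.adjoin ℂ
          ((M.commutant : Set (H →L[ℂ] H)) ∪ (M : Set (H →L[ℂ] H)))) = 0 := rfl
      simp only [h0, mul_zero, zero_mul, map_zero]
    | add X Y hX' hY' ihX ihY =>
      have mem_of_span {T : H →L[ℂ] H}
          (hT : T ∈ Submodule.span ℂ {T | ∃ A' ∈ M.commutant, ∃ B ∈ M, A' * B = T}) :
          T ∈ Algebra.adjoin ℂ ((M.commutant : Set (H →L[ℂ] H)) ∪ (M : Set (H →L[ℂ] H))) :=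
        span_le_adjoin_commutant_union M hT
      have hadd : (⟨X + Y, hX⟩ : Algebra.adjoin ℂ
          ((M.commutant : Set (H →L[ℂ] H)) ∪ (M : Set (H →L[ℂ] H)))) =
          ⟨X, mem_of_span hX'⟩ + ⟨Y, mem_of_span hY'⟩ := rfl
      simp only [hadd, mul_add, add_mul, map_add, ihX (mem_of_span hX'), ihY (mem_of_span hY')]
    | smul c X hX' ih =>
      have hm := span_le_adjoin_commutant_union M hX'
      have hsmul : (⟨c • X, hX⟩ : Algebra.adjoin ℂ
          ((M.commutant : Set (H →L[ℂ] H)) ∪ (M : Set (H →L[ℂ] H)))) = c • ⟨X, hm⟩ := rfl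
      simp only [hsmul, mul_smul_comm, smul_mul_assoc, map_smul, ih hm]
  · intro h
    let ψ : Subalgebra.toSubmodule M.toStarSubalgebra.toSubalgebra →ₗ[ℂ] (H →L[ℂ] H) :=
      { toFun := fun B => Φ ⟨B, Algebra.subset_adjoin (Set.mem_union_right _ B.2)⟩
        map_add' := fun B C => congrArg Subtype.val (map_add Φ
          ⟨B, Algebra.subset_adjoin (Set.mem_union_right _ B.2)⟩
          ⟨C, Algebra.subset_adjoin (Set.mem_union_right _ C.2)⟩)
        map_smul' := fun c B => congrArg Subtype.val (map_smul Φ c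
          ⟨B, Algebra.subset_adjoin (Set.mem_union_right _ B.2)⟩) }
    obtain ⟨φ, hφψ⟩ := ψ.exists_extend
    have hφ (B : H →L[ℂ] H) (hB : B ∈ M) :
        φ B = Φ ⟨B, Algebra.subset_adjoin (Set.mem_union_right _ hB)⟩ :=
      LinearMap.congr_fun hφψ ⟨B, hB⟩
    have hleft (A : H →L[ℂ] H) (hA : A ∈ M.commutant) (B : H →L[ℂ] H) (hB : B ∈ M) :
        (Φ ⟨A * B, mul_mem (Algebra.subset_adjoin (Set.mem_union_left _ hA))
          (Algebra.subset_adjoin (Set.mem_union_right _ hB))⟩ : H →L[ℂ] H) = A * φ B := by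
      have h1 := congrArg Subtype.val (h A hA 1 (one_mem _)
        ⟨B, Algebra.subset_adjoin (Set.mem_union_right _ hB)⟩)
      simpa [hφ B hB] using h1
    have hright (A : H →L[ℂ] H) (hA : A ∈ M.commutant) (B : H →L[ℂ] H) (hB : B ∈ M) :
        (Φ ⟨B * A, mul_mem (Algebra.subset_adjoin (Set.mem_union_right _ hB))
          (Algebra.subset_adjoin (Set.mem_union_left _ hA))⟩ : H →L[ℂ] H) = φ B * A := by
      have h1 := congrArg Subtype.val (h 1 (one_mem _) A hA
        ⟨B, Algebra.subset_adjoin (Set.mem_union_right _ hB)⟩)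
      simpa [hφ B hB] using h1
    refine ⟨φ, fun B hB => ?_, fun A hA B hB => Subtype.ext (hleft A hA B hB)⟩
    rw [← M.commutant_commutant, VonNeumannAlgebra.mem_commutant_iff]
    intro A hA
    rw [← hleft A hA B hB, ← hright A hA B hB]
    exact congrArg (fun T => (Φ T : H →L[ℂ] H))
      (Subtype.ext (VonNeumannAlgebra.mem_commutant_iff.mp hA B hB).symm)

end ChoiInf
end
end

section
/- For a linear map φ ∈ CB^σ_e(M), the following are equivalent: (i) φ : M → M is completely positive; (ii) the normal extension φ̃ : B(H) → B(H) is completely positive; (iii) φ̃ : B(H) → B(H) is positive; (iv) C_φ is a positive operator in B(H); (v) D_φ is a positive operator in T(H); (vi) φ = Σ_{i=1}^∞ Ad_{V_i} in the point-weak topology with V_i ∈ M and Σ_{i=1}^∞ V_i*V_i ≤ ‖φ‖_cb · I. -/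
set_option synthInstance.maxHeartbeats 1000000
set_option maxHeartbeats 1000000

noncomputable section

open scoped InnerProductSpace ComplexOrder
open ContinuousLinearMap

local notation "⟪" x ", " y "⟫" => @inner ℂ _ _ x y

namespace ChoiInf

variable {H : Type*} [NormedAddCommGroup H] [InnerProductSpace ℂ H] [CompleteSpace H]

variable {K : Type*} [NormedAddCommGroup K] [InnerProductSpace ℂ K] [CompleteSpace K]

variable {H : Type*} [NormedAddCommGroup H] [InnerProductSpace ℂ H] [CompleteSpace H]
  {ι : Type*} {e : HilbertBasis ι ℂ K}

set_option linter.unusedSectionVars false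

/-- A square-summably bounded family of operators assembles into an operator into `ℓ²`. -/
theorem exists_lp_map {E F κ : Type*} [NormedAddCommGroup E] [InnerProductSpace ℂ E]
    [NormedAddCommGroup F] [InnerProductSpace ℂ F] (a : κ → E →L[ℂ] F) (C : ℝ)
    (h : ∀ v, ∀ s : Finset κ, ∑ i ∈ s, ‖a i v‖ ^ 2 ≤ C * ‖v‖ ^ 2) :
    ∃ A : E →L[ℂ] lp (fun _ : κ => F) 2, ∀ v i, A v i = a i v := by
  have hC : 0 ≤ |C| := abs_nonneg C
  have h' : ∀ v, ∀ s : Finset κ, ∑ i ∈ s, ‖a i v‖ ^ 2 ≤ (√|C| * ‖v‖) ^ 2 := fun v s => by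
    rw [mul_pow, Real.sq_sqrt hC]
    exact (h v s).trans (by gcongr; exact le_abs_self C)
  let L : E →ₗ[ℂ] lp (fun _ : κ => F) 2 :=
    { toFun v := ⟨fun i => a i v, memℓp_gen' (C := (√|C| * ‖v‖) ^ 2)
        fun s => by simpa using h' v s⟩
      map_add' v w := by ext i; exact map_add (a i) v w
      map_smul' c v := by ext i; exact map_smul (a i) c v }
  refine ⟨L.mkContinuous √|C| fun v => lp.norm_le_of_forall_sum_le (by norm_num) (by positivity)
    fun s => ?_, fun v i => rfl⟩
  simpa using! h' v s

theorem hasSum_norm_sq_inner (b : HilbertBasis ι ℂ H) (x : H) :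
    HasSum (fun j => ‖⟪x, b j⟫‖ ^ 2) (‖x‖ ^ 2) := by
  have h := (Complex.hasSum_re (b.hasSum_inner_mul_inner x x))
  rw [inner_self_eq_norm_sq_to_K] at h
  convert h using 1
  · ext j
    rw [← inner_conj_symm (b j) x, Complex.mul_conj, Complex.ofReal_re, Complex.normSq_eq_norm_sq]
  · norm_cast

/-- The two ways of summing `Σₙ ⟪pₙ, b j⟫ ⟪b j, qₙ⟫` agree. -/
theorem hasSum_inner_swap {κ : Type*} (b : HilbertBasis ι ℂ H) {p q : κ → H}
    (hp : Summable fun n => ‖p n‖ ^ 2) (hq : Summable fun n => ‖q n‖ ^ 2) {d : ι → ℂ}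
    (hd : ∀ j, HasSum (fun n => ⟪p n, b j⟫ * ⟪b j, q n⟫) (d j)) :
    ∃ s, HasSum (fun n => ⟪p n, q n⟫) s ∧ HasSum d s := by
  have key : ∀ {r : κ → H}, (Summable fun n => ‖r n‖ ^ 2) →
      Summable fun z : κ × ι => ‖⟪r z.1, b z.2⟫‖ ^ 2 := fun {r} hr => by
    refine (summable_prod_of_nonneg fun _ => by positivity).2
      ⟨fun n => (hasSum_norm_sq_inner b (r n)).summable, ?_⟩
    simpa only [(hasSum_norm_sq_inner b (r _)).tsum_eq] using hr
  have hS : Summable fun z : κ × ι => ⟪p z.1, b z.2⟫ * ⟪b z.2, q z.1⟫ := by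
    refine Summable.of_norm_bounded ((key hp).add (key hq)) fun z => ?_
    rw [norm_mul, norm_inner_symm (b z.2)]
    nlinarith [sq_nonneg (‖⟪p z.1, b z.2⟫‖ - ‖⟪q z.1, b z.2⟫‖),
      sq_nonneg (‖⟪p z.1, b z.2⟫‖), sq_nonneg ‖⟪q z.1, b z.2⟫‖]
  obtain ⟨s, hs⟩ := hS
  exact ⟨s, hs.prod_fiberwise fun n => b.hasSum_inner_mul_inner (p n) (q n),
    ((Equiv.prodComm ι κ).hasSum_iff.2 hs).prod_fiberwise hd⟩

/-- A trace class operator has a nuclear representation by square summable sequences. -/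
theorem IsTraceClass.exists_sq_summable {T : H →L[ℂ] H} (hT : IsTraceClass T) :
    ∃ x y : ℕ → H, (Summable fun n => ‖x n‖ ^ 2) ∧ (Summable fun n => ‖y n‖ ^ 2) ∧
      ∀ z, HasSum (fun n => ⟪y n, z⟫ • x n) (T z) := by
  obtain ⟨x, y, hs, hT⟩ := hT
  let r : ℕ → ℝ := fun n => √(‖x n‖ * ‖y n‖)
  have hr : ∀ n, r n ^ 2 = ‖x n‖ * ‖y n‖ := fun n => Real.sq_sqrt (by positivity)
  refine ⟨fun n => ((r n / ‖x n‖ : ℝ) : ℂ) • x n, fun n => ((‖x n‖ / r n : ℝ) : ℂ) • y n,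
    hs.congr_cofinite ?_, hs.congr_cofinite ?_, fun z => ?_⟩
  · refine Filter.Eventually.of_forall fun n => ?_
    simp only [norm_smul, Complex.norm_real, Real.norm_eq_abs, mul_pow, sq_abs, div_pow, hr]
    by_cases h : ‖x n‖ = 0
    · simp [h]
    · field_simp
  · refine Filter.Eventually.of_forall fun n => ?_
    simp only [norm_smul, Complex.norm_real, Real.norm_eq_abs, mul_pow, sq_abs, div_pow, hr]
    by_cases h : ‖x n‖ = 0
    · simp [h]
    by_cases h' : ‖y n‖ = 0
    · simp [h']
    · field_simp
  · have hsum : Summable fun n => ⟪y n, z⟫ • x n := by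
      refine Summable.of_norm_bounded (hs.mul_right ‖z‖) fun n => ?_
      rw [norm_smul]
      calc ‖⟪y n, z⟫‖ * ‖x n‖ ≤ (‖y n‖ * ‖z‖) * ‖x n‖ := by gcongr; exact norm_inner_le_norm _ _
        _ = _ := by ring
    rw [hT z]
    convert hsum.hasSum using 2 with n
    rw [inner_smul_left, Complex.conj_ofReal, smul_smul]
    by_cases h : ‖x n‖ = 0
    · simp [norm_eq_zero.1 h]
    by_cases h' : ‖y n‖ = 0
    · simp [norm_eq_zero.1 h']
    have h0 : r n ≠ 0 := by
      have := hr n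
      intro h0
      rw [h0] at this
      exact mul_ne_zero h h' (by simpa using this.symm)
    congr 1
    have : ((‖x n‖ / r n : ℝ) : ℂ) * ((r n / ‖x n‖ : ℝ) : ℂ) = 1 := by
      rw [← Complex.ofReal_mul]
      norm_cast
      field_simp
    calc _ = (((‖x n‖ / r n : ℝ) : ℂ) * ((r n / ‖x n‖ : ℝ) : ℂ)) * ⟪y n, z⟫ := by ring
      _ = _ := by rw [this, one_mul]

theorem summable_sq_apply {κ : Type*} (A : H →L[ℂ] H) {x : κ → H}
    (hx : Summable fun n => ‖x n‖ ^ 2) : Summable fun n => ‖A (x n)‖ ^ 2 := by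
  refine Summable.of_nonneg_of_le (fun _ => by positivity) (fun n => ?_) (hx.mul_left (‖A‖ ^ 2))
  rw [← mul_pow]
  gcongr
  exact A.le_opNorm _

/-- The trace pairing in terms of a square summable nuclear representation. -/
theorem hasSum_pairing (b : HilbertBasis ι ℂ H) {T : H →L[ℂ] H} {x y : ℕ → H}
    (hx : Summable fun n => ‖x n‖ ^ 2) (hy : Summable fun n => ‖y n‖ ^ 2)
    (hT : ∀ z, HasSum (fun n => ⟪y n, z⟫ • x n) (T z)) (A : H →L[ℂ] H) :
    HasSum (fun n => ⟪y n, A (x n)⟫) (pairing b A T) ∧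
      HasSum (fun j => ⟪b j, A (T (b j))⟫) (pairing b A T) := by
  obtain ⟨s, hs, hs'⟩ := hasSum_inner_swap b hy (summable_sq_apply A hx)
    (d := fun j => ⟪b j, A (T (b j))⟫) fun j => by
      simpa [inner_smul_right] using
        ((hT (b j)).mapL A).mapL (innerSL ℂ (b j))
  rw [show pairing b A T = s from hs'.tsum_eq]
  exact ⟨hs, hs'⟩

theorem isTraceClass_rankOne (x y : H) : IsTraceClass (rankOne x y) := by
  refine ⟨fun n => if n = 0 then x else 0, fun n => if n = 0 then y else 0, ?_, fun z => ?_⟩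
  · exact summable_of_ne_finset_zero (s := {0}) fun n hn => by
      simp [show n ≠ 0 by simpa using hn]
  · rw [tsum_eq_single 0 fun n hn => by simp [hn]]
    simp [rankOne]

theorem pairing_rankOne_right (b : HilbertBasis ι ℂ H) (A : H →L[ℂ] H) (x y : H) :
    pairing b A (rankOne x y) = ⟪y, A x⟫ := by
  rw [← (b.hasSum_inner_mul_inner y (A x)).tsum_eq]
  simp [pairing, tr, rankOne]

theorem pairing_rankOne_left (b : HilbertBasis ι ℂ H) (T : H →L[ℂ] H) (x y : H) :
    pairing b (rankOne x y) T = ⟪y, T x⟫ := by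
  rw [← adjoint_inner_left, ← (b.hasSum_inner_mul_inner _ x).tsum_eq]
  simp [pairing, tr, rankOne, adjoint_inner_left]

/-- The orthogonal projection onto an invariant subspace commutes with the operator when the
adjoint leaves the subspace invariant too. -/
theorem commute_starProjection {G : Type*} [NormedAddCommGroup G] [InnerProductSpace ℂ G]
    [CompleteSpace G] (K : Submodule ℂ G) [K.HasOrthogonalProjection] (S S' : G →L[ℂ] G)
    (hadj : ∀ f g, ⟪S' f, g⟫ = ⟪f, S g⟫) (hS : ∀ f ∈ K, S f ∈ K) (hS' : ∀ f ∈ K, S' f ∈ K)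
    (f : G) : K.starProjection (S f) = S (K.starProjection f) := by
  refine Submodule.eq_starProjection_of_mem_orthogonal (hS _ (K.starProjection_apply_mem f)) ?_
  rw [← map_sub, Submodule.mem_orthogonal]
  intro u hu
  rw [← hadj]
  exact (Submodule.mem_orthogonal _ _).1 (K.sub_starProjection_mem_orthogonal f) _ (hS' u hu)

/-- A vector separating for `M` is cyclic for the commutant. -/
theorem Separating.dense_commutant {M : VonNeumannAlgebra H} {x0 : H} (hsep : Separating M x0) :
    Dense {y : H | ∃ A ∈ M.commutant, A x0 = y} := by
  let K₀ : Submodule ℂ H :=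
    { carrier := {y : H | ∃ A ∈ M.commutant, A x0 = y}
      add_mem' := by
        rintro _ _ ⟨A, hA, rfl⟩ ⟨B, hB, rfl⟩
        exact ⟨A + B, add_mem hA hB, rfl⟩
      zero_mem' := ⟨0, zero_mem _, rfl⟩
      smul_mem' := by
        rintro c _ ⟨A, hA, rfl⟩
        exact ⟨c • A, M.commutant.toStarSubalgebra.smul_mem hA c, rfl⟩ }
  let K := K₀.topologicalClosure
  have : CompleteSpace K := K₀.isClosed_topologicalClosure.completeSpace_coe
  have hinv : ∀ A ∈ M.commutant, ∀ f ∈ K, A f ∈ K := fun A hA f hf =>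
    map_mem_closure A.continuous hf (by
      rintro _ ⟨B, hB, rfl⟩
      exact ⟨A * B, mul_mem hA hB, rfl⟩)
  have hP : K.starProjection ∈ M := by
    rw [← M.commutant_commutant, VonNeumannAlgebra.mem_commutant_iff]
    intro A hA
    ext f
    exact (commute_starProjection K A (star A)
      (fun f g => by rw [star_eq_adjoint, adjoint_inner_left])
      (hinv A hA) (hinv _ (star_mem hA)) f).symm
  have hx : x0 ∈ K := subset_closure ⟨1, one_mem _, rfl⟩
  have h1 : 1 - K.starProjection = 0 := hsep _ (sub_mem (one_mem _) hP) (by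
    simp [Submodule.starProjection_eq_self_iff.2 hx])
  intro f
  have : K.starProjection f = f := by
    exact (sub_eq_zero.1 (by simpa using congrArg (fun T => T f) h1)).symm
  exact Submodule.starProjection_eq_self_iff.1 this

/-- `alg(M', M)`, as the linear span of the products `A'B`. -/
def algSpan (M : VonNeumannAlgebra H) : Submodule ℂ (H →L[ℂ] H) :=
  Submodule.span ℂ {T | ∃ A' ∈ M.commutant, ∃ B ∈ M, T = A' * B}

theorem mul_mem_algSpan {M : VonNeumannAlgebra H} {A' B : H →L[ℂ] H} (hA : A' ∈ M.commutant)
    (hB : B ∈ M) : A' * B ∈ algSpan M :=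
  Submodule.subset_span ⟨A', hA, B, hB, rfl⟩

theorem commutant_comm {M : VonNeumannAlgebra H} {A' B : H →L[ℂ] H} (hA : A' ∈ M.commutant)
    (hB : B ∈ M) : B * A' = A' * B :=
  VonNeumannAlgebra.mem_commutant_iff.1 hA B hB

/-- The elements of `alg(M', M)` are the finite sums `Σ A'ₖ Bₖ`. -/
theorem exists_sum_of_mem_algSpan {M : VonNeumannAlgebra H} {T : H →L[ℂ] H} (hT : T ∈ algSpan M) :
    ∃ (m : ℕ) (A B : Fin m → (H →L[ℂ] H)), (∀ k, A k ∈ M.commutant) ∧ (∀ k, B k ∈ M) ∧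
      T = ∑ k, A k * B k := by
  induction hT using Submodule.span_induction with
  | mem T hT =>
    obtain ⟨A, hA, B, hB, rfl⟩ := hT
    exact ⟨1, fun _ => A, fun _ => B, fun _ => hA, fun _ => hB, by simp⟩
  | zero => exact ⟨0, fun _ => 0, fun _ => 0, fun _ => zero_mem _, fun _ => zero_mem _, by simp⟩
  | add S T _ _ hS hT =>
    obtain ⟨m, A, B, hA, hB, rfl⟩ := hS
    obtain ⟨n, A', B', hA', hB', rfl⟩ := hT
    refine ⟨m + n, Fin.append A A', Fin.append B B', fun k => ?_, fun k => ?_, ?_⟩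
    · refine Fin.addCases (fun i => ?_) (fun i => ?_) k <;> simp [hA, hA']
    · refine Fin.addCases (fun i => ?_) (fun i => ?_) k <;> simp [hB, hB']
    · simp [Fin.sum_univ_add]
  | smul c T _ hT =>
    obtain ⟨m, A, B, hA, hB, rfl⟩ := hT
    refine ⟨m, fun k => c • A k, B, fun k => M.commutant.toStarSubalgebra.smul_mem (hA k) c, hB, ?_⟩
    simp [Finset.smul_sum]

theorem mul_mem_algSpan_left {M : VonNeumannAlgebra H} {S T : H →L[ℂ] H}
    (hS : S ∈ M.commutant ∨ S ∈ M) (hT : T ∈ algSpan M) : S * T ∈ algSpan M := by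
  obtain ⟨m, A, B, hA, hB, rfl⟩ := exists_sum_of_mem_algSpan hT
  rw [Finset.mul_sum]
  refine sum_mem fun k _ => ?_
  rcases hS with hS | hS
  · rw [← mul_assoc]
    exact mul_mem_algSpan (mul_mem hS (hA k)) (hB k)
  · rw [← mul_assoc, commutant_comm (hA k) hS, mul_assoc]
    exact mul_mem_algSpan (hA k) (mul_mem hS (hB k))

/-- Every operator acts diagonally on `ℓ²(κ, H)`. -/
theorem exists_amplification (κ : Type*) (T : H →L[ℂ] H) :
    ∃ A : lp (fun _ : κ => H) 2 →L[ℂ] lp (fun _ : κ => H) 2, ∀ f i, A f i = T (f i) :=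
  exists_lp_map (fun i => T ∘L lp.evalCLM ℂ (fun _ : κ => H) 2 i) (‖T‖ ^ 2) fun f s => by
    calc ∑ i ∈ s, ‖T (f i)‖ ^ 2 ≤ ∑ i ∈ s, ‖T‖ ^ 2 * ‖f i‖ ^ 2 := by
          refine Finset.sum_le_sum fun i _ => ?_
          rw [← mul_pow]
          gcongr
          exact T.le_opNorm _
      _ = ‖T‖ ^ 2 * ∑ i ∈ s, ‖f i‖ ^ 2 := by rw [Finset.mul_sum]
      _ ≤ _ := by
          gcongr
          simpa using lp.sum_rpow_le_norm_rpow (p := 2) (by norm_num) f s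

/-- The diagonal action of an operator on `ℓ²(κ, H)`. -/
def ampl (κ : Type*) (T : H →L[ℂ] H) : lp (fun _ : κ => H) 2 →L[ℂ] lp (fun _ : κ => H) 2 :=
  (exists_amplification κ T).choose

@[simp] theorem ampl_apply {κ : Type*} (T : H →L[ℂ] H) (f : lp (fun _ : κ => H) 2) (i : κ) :
    ampl κ T f i = T (f i) :=
  (exists_amplification κ T).choose_spec f i

/-- Density of `alg(M', M)` in `B(H)` for a factor `M`, in the ultrastrong topology. -/
theorem ampl_mem_closure {κ : Type*} {M : VonNeumannAlgebra H} (hM : IsFactor M)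
    (ξ : lp (fun _ : κ => H) 2) (T : H →L[ℂ] H) :
    ampl κ T ξ ∈ closure {g | ∃ S ∈ algSpan M, ampl κ S ξ = g} := by
  classical
  let K₀ : Submodule ℂ (lp (fun _ : κ => H) 2) :=
    { carrier := {g | ∃ S ∈ algSpan M, ampl κ S ξ = g}
      add_mem' := by
        rintro _ _ ⟨A, hA, rfl⟩ ⟨B, hB, rfl⟩
        exact ⟨A + B, add_mem hA hB, by ext i; simp⟩
      zero_mem' := ⟨0, zero_mem _, by ext i; simp⟩
      smul_mem' := by
        rintro c _ ⟨A, hA, rfl⟩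
        exact ⟨c • A, Submodule.smul_mem _ c hA, by ext i; simp⟩ }
  let K := K₀.topologicalClosure
  have : CompleteSpace K := K₀.isClosed_topologicalClosure.completeSpace_coe
  have hinv : ∀ A, (A ∈ M.commutant ∨ A ∈ M) → ∀ f ∈ K, ampl κ A f ∈ K := fun A hA f hf =>
    map_mem_closure (ampl κ A).continuous hf (by
      rintro _ ⟨B, hB, rfl⟩
      exact ⟨A * B, mul_mem_algSpan_left hA hB, by ext i; simp⟩)
  have hcomm : ∀ A, (A ∈ M.commutant ∨ A ∈ M) → ∀ f,
      K.starProjection (ampl κ A f) = ampl κ A (K.starProjection f) := fun A hA =>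
    commute_starProjection K (ampl κ A) (ampl κ (star A))
      (fun f g => by
        rw [lp.inner_eq_tsum, lp.inner_eq_tsum]
        simp [star_eq_adjoint, adjoint_inner_left])
      (hinv A hA) (hinv _ (hA.imp star_mem star_mem))
  let P : κ → κ → H →L[ℂ] H := fun m n => lp.evalCLM ℂ (fun _ : κ => H) 2 m ∘L K.starProjection ∘L
    lp.singleContinuousLinearMap ℂ (fun _ : κ => H) 2 n
  have hsingle : ∀ (A : H →L[ℂ] H) n h, ampl κ A (lp.single 2 n h) = lp.single 2 n (A h) :=
    fun A n h => by
      ext i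
      by_cases hi : i = n
      · subst hi; simp
      · simp [hi]
  have hPcomm : ∀ m n A, (A ∈ M.commutant ∨ A ∈ M) → A * P m n = P m n * A := fun m n A hA => by
    ext h
    change A (K.starProjection (lp.single 2 n h) m) = K.starProjection (lp.single 2 n (A h)) m
    rw [← hsingle, hcomm A hA, ampl_apply]
  have hscal : ∀ m n, ∃ c : ℂ, P m n = c • (1 : H →L[ℂ] H) := fun m n => by
    refine hM _ ?_ (VonNeumannAlgebra.mem_commutant_iff.2 fun A hA => hPcomm m n A (.inr hA))
    rw [← M.commutant_commutant, VonNeumannAlgebra.mem_commutant_iff]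
    exact fun A hA => hPcomm m n A (.inl hA)
  have hall : K.starProjection ∘L ampl κ T = ampl κ T ∘L K.starProjection := by
    refine lp.ext_continuousLinearMap (by norm_num) fun n => ?_
    ext h m
    obtain ⟨c, hc⟩ := hscal m n
    have hc' : ∀ h, K.starProjection (lp.single 2 n h) m = c • h := fun h =>
      congrArg (fun S => S h) hc
    change K.starProjection (ampl κ T (lp.single 2 n h)) m =
      ampl κ T (K.starProjection (lp.single 2 n h)) m
    rw [hsingle, ampl_apply, hc', hc', map_smul]
  have hξ : ξ ∈ K := subset_closure
    ⟨1, by simpa using mul_mem_algSpan (one_mem M.commutant) (one_mem M), by ext i; simp⟩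
  have h := congrArg (fun S => S ξ) hall
  have hfix : K.starProjection (ampl κ T ξ) = ampl κ T ξ := by
    simpa [Submodule.starProjection_eq_self_iff.2 hξ] using h
  exact Submodule.starProjection_eq_self_iff.1 hfix

/-- Functionals on `B(H)` of the form `T ↦ Σₙ ⟪yₙ, T xₙ⟫` with square summable `x`, `y`. -/
def IsNormalFunctional (f : (H →L[ℂ] H) → ℂ) : Prop :=
  ∃ x y : ℕ → H, (Summable fun n => ‖x n‖ ^ 2) ∧ (Summable fun n => ‖y n‖ ^ 2) ∧
    ∀ T, HasSum (fun n => ⟪y n, T (x n)⟫) (f T)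

theorem memℓp_two_sumElim {x y : ℕ → H} (hx : Summable fun n => ‖x n‖ ^ 2)
    (hy : Summable fun n => ‖y n‖ ^ 2) :
    Memℓp (E := fun _ : ℕ ⊕ ℕ => H) (Sum.elim x y) 2 :=
  memℓp_gen (Summable.sum _ (by simpa [Function.comp_def] using hx)
    (by simpa [Function.comp_def] using hy))

theorem IsNormalFunctional.comp_mul {f : (H →L[ℂ] H) → ℂ} (hf : IsNormalFunctional f)
    (A B : H →L[ℂ] H) : IsNormalFunctional fun T => f (A * T * B) := by
  obtain ⟨x, y, hx, hy, h⟩ := hf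
  refine ⟨fun n => B (x n), fun n => star A (y n), summable_sq_apply B hx,
    summable_sq_apply _ hy, fun T => ?_⟩
  simpa [star_eq_adjoint, adjoint_inner_left] using h (A * T * B)

/-- Normal functionals agreeing on `alg(M', M)` are equal when `M` is a factor. -/
theorem IsNormalFunctional.eq_of_eqOn {M : VonNeumannAlgebra H} (hM : IsFactor M)
    {f g : (H →L[ℂ] H) → ℂ} (hf : IsNormalFunctional f) (hg : IsNormalFunctional g)
    (h : ∀ S ∈ algSpan M, f S = g S) (T : H →L[ℂ] H) : f T = g T := by
  obtain ⟨x, y, hx, hy, hf⟩ := hf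
  obtain ⟨x', y', hx', hy', hg⟩ := hg
  let ξ : lp (fun _ : ℕ ⊕ ℕ => H) 2 := ⟨Sum.elim x x', memℓp_two_sumElim hx hx'⟩
  let Y : lp (fun _ : ℕ ⊕ ℕ => H) 2 :=
    ⟨Sum.elim y fun n => -y' n, memℓp_two_sumElim hy (by simpa using hy')⟩
  have key : ∀ S, ⟪Y, ampl _ S ξ⟫ = f S - g S := fun S => by
    refine (lp.hasSum_inner Y (ampl _ S ξ)).unique ?_
    rw [sub_eq_add_neg]
    refine HasSum.sum ?_ ?_
    · simpa [Function.comp_def, Y, ξ] using hf S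
    · simpa [Function.comp_def, Y, ξ] using (hg S).neg
  have hcl : IsClosed {v : lp (fun _ : ℕ ⊕ ℕ => H) 2 | ⟪Y, v⟫ = 0} :=
    isClosed_eq (by fun_prop) continuous_const
  have := closure_minimal (s := {v | ∃ S ∈ algSpan M, ampl _ S ξ = v}) (by
    rintro _ ⟨S, hS, rfl⟩
    simp [key, h S hS]) hcl (ampl_mem_closure hM ξ T)
  exact sub_eq_zero.1 ((key T).symm.trans this)

theorem exists_lp_pullback {κ κ' : Type*} (e : κ → κ') (he : Function.Injective e) :
    ∃ A : lp (fun _ : κ' => H) 2 →L[ℂ] lp (fun _ : κ => H) 2, ∀ f i, A f i = f (e i) :=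
  exists_lp_map (fun i => lp.evalCLM ℂ (fun _ : κ' => H) 2 (e i)) 1 fun f s => by
    have := lp.sum_rpow_le_norm_rpow (p := 2) (by norm_num) f (s.map ⟨e, he⟩)
    simpa using! this

/-- A normal functional that is positive on `alg(M', M)` is positive when `M` is a factor. -/
theorem IsNormalFunctional.nonneg_of_nonneg {M : VonNeumannAlgebra H} (hM : IsFactor M)
    {f : (H →L[ℂ] H) → ℂ} (hf : IsNormalFunctional f)
    (h : ∀ S ∈ algSpan M, 0 ≤ f (star S * S)) (T : H →L[ℂ] H) : 0 ≤ f (star T * T) := by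
  obtain ⟨x, y, hx, hy, hf⟩ := hf
  let ξ : lp (fun _ : ℕ ⊕ ℕ => H) 2 := ⟨Sum.elim y x, memℓp_two_sumElim hy hx⟩
  obtain ⟨L, hL⟩ := exists_lp_pullback (H := H) (Sum.inl : ℕ → ℕ ⊕ ℕ) Sum.inl_injective
  obtain ⟨R, hR⟩ := exists_lp_pullback (H := H) (Sum.inr : ℕ → ℕ ⊕ ℕ) Sum.inr_injective
  have key : ∀ S, ⟪L (ampl _ S ξ), R (ampl _ S ξ)⟫ = f (star S * S) := fun S => by
    refine (lp.hasSum_inner (L (ampl _ S ξ)) (R (ampl _ S ξ))).unique ?_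
    simpa [hL, hR, ξ, star_eq_adjoint, adjoint_inner_right] using hf (star S * S)
  have hcl : IsClosed {v : lp (fun _ : ℕ ⊕ ℕ => H) 2 | 0 ≤ ⟪L v, R v⟫} :=
    isClosed_le continuous_const (by fun_prop)
  rw [← key]
  exact closure_minimal (s := {v | ∃ S ∈ algSpan M, ampl _ S ξ = v}) (by
    rintro _ ⟨S, hS, rfl⟩
    exact (h S hS).trans_eq (key S).symm) hcl (ampl_mem_closure hM ξ T)

section NormalPair

variable {b : HilbertBasis ι ℂ H} {M : VonNeumannAlgebra H}
  {φ Φ Φst : (H →L[ℂ] H) →ₗ[ℂ] (H →L[ℂ] H)}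

theorem IsNormalPair.inner_apply (hnp : IsNormalPair b Φ Φst) (A : H →L[ℂ] H) (v w : H) :
    ⟪w, Φ A v⟫ = pairing b A (Φst (rankOne v w)) := by
  rw [← hnp.2 _ _ (isTraceClass_rankOne v w), pairing_rankOne_right]

theorem IsNormalPair.inner_predual (hnp : IsNormalPair b Φ Φst) (x y v w : H) :
    ⟪y, Φst (rankOne v w) x⟫ = ⟪w, Φ (rankOne x y) v⟫ := by
  rw [hnp.inner_apply, pairing_rankOne_left]

theorem IsNormalPair.hasSum_inner (hnp : IsNormalPair b Φ Φst) (A : H →L[ℂ] H) (v w : H) :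
    HasSum (fun j => ⟪b j, A (Φst (rankOne v w) (b j))⟫) ⟪w, Φ A v⟫ := by
  obtain ⟨x, y, hx, hy, h⟩ := (hnp.1 _ (isTraceClass_rankOne v w)).exists_sq_summable
  rw [hnp.inner_apply]
  exact (hasSum_pairing b hx hy h A).2

theorem IsNormalPair.isNormalFunctional (hnp : IsNormalPair b Φ Φst) (v w : H) :
    IsNormalFunctional fun A => ⟪w, Φ A v⟫ := by
  obtain ⟨x, y, hx, hy, h⟩ := (hnp.1 _ (isTraceClass_rankOne v w)).exists_sq_summable
  refine ⟨x, y, hx, hy, fun A => ?_⟩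
  dsimp only
  rw [hnp.inner_apply]
  exact (hasSum_pairing b hx hy h A).1

/-- The normal extension is an `M'`-bimodule map. -/
theorem ExtendsTilde.map_mul_mul (hM : IsFactor M) (hmem : ∀ B ∈ M, φ B ∈ M)
    (hext : ExtendsTilde M φ Φ) (hnp : IsNormalPair b Φ Φst) {A' B' : H →L[ℂ] H}
    (hA : A' ∈ M.commutant) (hB : B' ∈ M.commutant) (T : H →L[ℂ] H) :
    Φ (A' * T * B') = A' * Φ T * B' := by
  have halg : ∀ S ∈ algSpan M, Φ (A' * S * B') = A' * Φ S * B' := fun S hS => by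
    induction hS using Submodule.span_induction with
    | mem S hS =>
      obtain ⟨C, hC, D, hD, rfl⟩ := hS
      rw [show A' * (C * D) * B' = (A' * C * B') * D by
        rw [mul_assoc, mul_assoc C, commutant_comm hB hD]; simp only [mul_assoc],
        hext _ (mul_mem (mul_mem hA hC) hB) _ hD, hext _ hC _ hD]
      simp only [mul_assoc]
      rw [commutant_comm hB (hmem D hD)]
    | zero => simp
    | add S T _ _ hS hT => simp only [mul_add, add_mul, map_add, hS, hT]
    | smul c T _ hT => simp only [mul_smul_comm, smul_mul_assoc, map_smul, hT]
  ext v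
  refine ext_inner_left ℂ fun w => ?_
  have := IsNormalFunctional.eq_of_eqOn hM ((hnp.isNormalFunctional v w).comp_mul A' B')
    (hnp.isNormalFunctional (B' v) (star A' w)) (fun S hS => by
      simp [halg S hS, star_eq_adjoint, adjoint_inner_left]) T
  simpa [star_eq_adjoint, adjoint_inner_left] using this

theorem isPositive_of_inner_nonneg {T : H →L[ℂ] H} (h : ∀ v, 0 ≤ ⟪v, T v⟫) : T.IsPositive := by
  rw [isPositive_iff_complex]
  intro x
  have hx : 0 ≤ ⟪T x, x⟫ := by
    rw [← inner_conj_symm, (Complex.conj_eq_iff_im.2 (Complex.nonneg_iff.1 (h x)).2.symm)]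
    exact h x
  obtain ⟨h1, h2⟩ := Complex.nonneg_iff.1 hx
  exact ⟨Complex.ext (by simp) (by simp [← h2]), h1⟩

theorem inner_nonneg_of_isPositive {T : H →L[ℂ] H} (h : T.IsPositive) (v : H) : 0 ≤ ⟪v, T v⟫ := by
  simpa using h.inner_nonneg_right v

/-- Complete positivity on `M` gives positivity of the normal extension. -/
theorem IsCPOn.isPositive_map (hM : IsFactor M) (hmem : ∀ B ∈ M, φ B ∈ M)
    (hext : ExtendsTilde M φ Φ) (hnp : IsNormalPair b Φ Φst) (hφ : IsCPOn M φ)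
    {T : H →L[ℂ] H} (hT : T.IsPositive) : (Φ T).IsPositive := by
  obtain ⟨R, rfl⟩ := CStarAlgebra.nonneg_iff_eq_star_mul_self.1 ((nonneg_iff_isPositive T).2 hT)
  refine isPositive_of_inner_nonneg fun v =>
    (hnp.isNormalFunctional v v).nonneg_of_nonneg hM (fun S hS => ?_) R
  obtain ⟨m, A, B, hA, hB, rfl⟩ := exists_sum_of_mem_algSpan hS
  have hcp := hφ m (fun i j => star (B i) * B j) (fun i j => mul_mem (star_mem (hB i)) (hB j))
    (fun u => by
      have : ∑ i, ∑ j, ⟪u i, (star (B i) * B j) (u j)⟫ =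
          ⟪∑ i, B i (u i), ∑ j, B j (u j)⟫ := by
        rw [sum_inner]
        refine Finset.sum_congr rfl fun i _ => ?_
        rw [inner_sum]
        simp [star_eq_adjoint, adjoint_inner_right]
      rw [this, inner_self_eq_norm_sq_to_K]
      norm_cast
      positivity) (fun i => A i v)
  convert hcp using 1
  have hprod : star (∑ k, A k * B k) * ∑ k, A k * B k =
      ∑ i, ∑ j, (star (A i) * A j) * (star (B i) * B j) := by
    simp only [star_sum, star_mul, Finset.sum_mul, Finset.mul_sum]
    rw [Finset.sum_comm]
    refine Finset.sum_congr rfl fun i _ => Finset.sum_congr rfl fun j _ => ?_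
    rw [← mul_assoc _ (A j), mul_assoc _ _ (A j),
      commutant_comm (mul_mem (star_mem (hA i)) (hA j)) (star_mem (hB i))]
    simp only [mul_assoc]
  simp only [hprod, map_sum]
  simp only [sum_apply, inner_sum]
  refine Finset.sum_congr rfl fun i _ => Finset.sum_congr rfl fun j _ => ?_
  rw [hext _ (mul_mem (star_mem (hA i)) (hA j)) _ (mul_mem (star_mem (hB i)) (hB j)), mul_assoc,
    ← commutant_comm (hA j) (hmem _ (mul_mem (star_mem (hB i)) (hB j)))]
  simp [star_eq_adjoint, adjoint_inner_right]

end NormalPair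

section Kraus

variable {b : HilbertBasis ι ℂ H} {M : VonNeumannAlgebra H}
  {φ Φ Φst : (H →L[ℂ] H) →ₗ[ℂ] (H →L[ℂ] H)} {x0 : H}

/-- The commutant as a subspace of `B(H)`. -/
def commutantSubmodule (M : VonNeumannAlgebra H) : Submodule ℂ (H →L[ℂ] H) where
  carrier := {A | A ∈ M.commutant}
  add_mem' hA hB := M.commutant.toStarSubalgebra.add_mem hA hB
  zero_mem' := M.commutant.toStarSubalgebra.zero_mem
  smul_mem' c _ hA := M.commutant.toStarSubalgebra.smul_mem hA c

/-- The orbit map `A' ↦ A'u` on the commutant. -/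
def orbitMap (M : VonNeumannAlgebra H) (u : H) : commutantSubmodule M →ₗ[ℂ] H where
  toFun A := A.1 u
  map_add' _ _ := rfl
  map_smul' _ _ := rfl

theorem Separating.denseRange_orbitMap (hsep : Separating M x0) : DenseRange (orbitMap M x0) := by
  have : Set.range (orbitMap M x0) = {y | ∃ A ∈ M.commutant, A x0 = y} := by
    ext y
    exact ⟨fun ⟨A, hA⟩ => ⟨A.1, A.2, hA⟩, fun ⟨A, hA, h⟩ => ⟨⟨A, hA⟩, h⟩⟩
  rw [DenseRange, this]
  exact hsep.dense_commutant

/-- If `A'x0 ↦ A'u` is weakly bounded then it extends to an operator in `M`. -/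
theorem exists_mem_of_weak_bound (hsep : Separating M x0) (u : H) (c : H → ℝ)
    (h : ∀ A ∈ M.commutant, ∀ x, ‖⟪A u, x⟫‖ ≤ c x * ‖A x0‖) :
    ∃ V ∈ M, ∀ A ∈ M.commutant, V (A x0) = A u := by
  let g : commutantSubmodule M → H →L[ℂ] ℂ := fun A =>
    ((‖A.1 x0‖⁻¹ : ℝ) : ℂ) • innerSL ℂ (A.1 u)
  obtain ⟨C, hC⟩ := banach_steinhaus (g := g) fun x => ⟨|c x|, fun A => by
    simp only [g, smul_apply, innerSL_apply_apply, norm_smul, Complex.norm_real, norm_inv,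
      norm_norm]
    by_cases h0 : ‖A.1 x0‖ = 0
    · simp [h0]
    rw [inv_mul_le_iff₀ (by positivity), mul_comm]
    exact (h _ A.2 x).trans (by gcongr; exact le_abs_self _)⟩
  have hbound : ∀ A, ‖orbitMap M u A‖ ≤ C * ‖orbitMap M x0 A‖ := fun A => by
    change ‖A.1 u‖ ≤ C * ‖A.1 x0‖
    by_cases h0 : ‖A.1 x0‖ = 0
    · have := h _ A.2 (A.1 u)
      rw [h0, mul_zero, norm_le_zero_iff, inner_self_eq_zero] at this
      simp [this, h0]
    · have := hC A
      simp only [g, norm_smul, Complex.norm_real, norm_inv, norm_norm, innerSL_apply_norm] at this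
      rwa [inv_mul_le_iff₀ (by positivity), mul_comm] at this
  let V : H →L[ℂ] H := (orbitMap M u).extendOfNorm (orbitMap M x0)
  have hV : ∀ A ∈ M.commutant, V (A x0) = A u := fun A hA =>
    LinearMap.extendOfNorm_eq hsep.denseRange_orbitMap ⟨C, hbound⟩ ⟨A, hA⟩
  refine ⟨V, ?_, hV⟩
  rw [← M.commutant_commutant, VonNeumannAlgebra.mem_commutant_iff]
  intro B hB
  ext f
  refine hsep.denseRange_orbitMap.induction_on (p := fun f => (B * V) f = (V * B) f) f
    (isClosed_eq (by fun_prop) (by fun_prop)) fun A => ?_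
  change B (V (A.1 x0)) = V ((B * A.1) x0)
  rw [hV _ A.2, hV _ (mul_mem hB A.2)]
  rfl

theorem norm_sq_inner_eq (x y : H) : ((‖⟪x, y⟫‖ ^ 2 : ℝ) : ℂ) = ⟪x, y⟫ * ⟪y, x⟫ := by
  rw [← inner_conj_symm y x, Complex.mul_conj, Complex.normSq_eq_norm_sq]

/-- The matrix coefficients of `Φ` on rank one operators in terms of a factorization of `D_φ`. -/
theorem hasSum_inner_map_rankOne (hM : IsFactor M) (hmem : ∀ B ∈ M, φ B ∈ M)
    (hext : ExtendsTilde M φ Φ) (hnp : IsNormalPair b Φ Φst) {R : H →L[ℂ] H}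
    (hR : Φst (rankOne x0 x0) = star R * R) {A B : H →L[ℂ] H} (hA : A ∈ M.commutant)
    (hB : B ∈ M.commutant) (x y : H) :
    HasSum (fun i => ⟪B (star R (b i)), x⟫ * ⟪y, A (star R (b i))⟫)
      ⟪B x0, Φ (rankOne x y) (A x0)⟫ := by
  have h1 : star B * rankOne x y * A = rankOne (star B x) (star A y) := by
    ext z
    simp [rankOne, star_eq_adjoint, adjoint_inner_left]
  have h2 := congrArg (fun S => ⟪x0, S x0⟫) (hext.map_mul_mul hM hmem hnp (star_mem hB) hA
    (rankOne x y))
  simp only [h1] at h2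
  rw [← hnp.inner_predual, hR] at h2
  have h3 : ⟪B x0, Φ (rankOne x y) (A x0)⟫ = ⟪R (star A y), R (star B x)⟫ := by
    simpa [star_eq_adjoint, adjoint_inner_right] using h2.symm
  rw [h3]
  refine (b.hasSum_inner_mul_inner (R (star A y)) (R (star B x))).congr_fun fun i => ?_
  rw [mul_comm, star_eq_adjoint, star_eq_adjoint, star_eq_adjoint, ← adjoint_inner_left A,
    adjoint_inner_right R, ← adjoint_inner_right B, adjoint_inner_left R]

/-- If `D_φ` is positive then `Φ` has a Kraus decomposition with coefficients in `M`. -/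
theorem exists_kraus (hM : IsFactor M) (hsep : Separating M x0) (hmem : ∀ B ∈ M, φ B ∈ M)
    (hext : ExtendsTilde M φ Φ) (hnp : IsNormalPair b Φ Φst)
    (hD : (Φst (rankOne x0 x0)).IsPositive) :
    ∃ V : ι → H →L[ℂ] H, (∀ i, V i ∈ M) ∧
      ∀ T v w, HasSum (fun i => ⟪w, (star (V i) * T * V i) v⟫) ⟪w, Φ T v⟫ := by
  obtain ⟨R, hR⟩ := CStarAlgebra.nonneg_iff_eq_star_mul_self.1 ((nonneg_iff_isPositive _).2 hD)
  have hsum := fun {A B : H →L[ℂ] H} (hA : A ∈ M.commutant) (hB : B ∈ M.commutant) x y =>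
    hasSum_inner_map_rankOne hM hmem hext hnp hR hA hB x y
  have hsq : ∀ A ∈ M.commutant, ∀ x, ∀ s : Finset ι,
      ∑ i ∈ s, ‖⟪x, A (star R (b i))⟫‖ ^ 2 ≤ ‖Φ (rankOne x x)‖ * ‖A x0‖ ^ 2 := fun A hA x s => by
    have h := Complex.hasSum_re (hsum hA hA x x)
    have h' : HasSum (fun i => ‖⟪x, A (star R (b i))⟫‖ ^ 2)
        (⟪A x0, Φ (rankOne x x) (A x0)⟫).re := by
      refine h.congr_fun fun i => ?_
      rw [mul_comm, ← norm_sq_inner_eq, Complex.ofReal_re]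
    refine (sum_le_hasSum s (fun _ _ => by positivity) h').trans ?_
    calc _ ≤ ‖⟪A x0, Φ (rankOne x x) (A x0)⟫‖ := Complex.re_le_norm _
      _ ≤ ‖A x0‖ * (‖Φ (rankOne x x)‖ * ‖A x0‖) :=
        (norm_inner_le_norm _ _).trans (by gcongr; exact le_opNorm _ _)
      _ = _ := by ring
  have hV : ∀ i, ∃ V ∈ M, ∀ A ∈ M.commutant, V (A x0) = A (star R (b i)) := fun i =>
    exists_mem_of_weak_bound hsep _ (fun x => √‖Φ (rankOne x x)‖) fun A hA x => by
      rw [norm_inner_symm, ← Real.sqrt_sq (norm_nonneg (A x0)), ← Real.sqrt_mul (norm_nonneg _)]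
      exact Real.le_sqrt_of_sq_le (by simpa using hsq A hA x {i})
  choose V hVM hV using hV
  refine ⟨V, hVM, ?_⟩
  have hdense := hsep.denseRange_orbitMap
  have hVsq : ∀ x v, ∀ s : Finset ι,
      ∑ i ∈ s, ‖⟪x, V i v⟫‖ ^ 2 ≤ ‖Φ (rankOne x x)‖ * ‖v‖ ^ 2 := fun x v s => by
    refine hdense.induction_on v (isClosed_le (by fun_prop) (by fun_prop)) fun A => ?_
    change ∑ i ∈ s, ‖⟪x, V i (A.1 x0)⟫‖ ^ 2 ≤ ‖Φ (rankOne x x)‖ * ‖A.1 x0‖ ^ 2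
    simpa only [hV _ _ A.2] using hsq A.1 A.2 x s
  choose a ha using fun x => exists_lp_map (fun i => innerSL ℂ x ∘L V i) _ (hVsq x)
  have hinner : ∀ x y v w, ⟪a x w, a y v⟫ = ⟪w, Φ (rankOne x y) v⟫ := fun x y v w => by
    refine hdense.induction_on₂ (p := fun v w => ⟪a x w, a y v⟫ = ⟪w, Φ (rankOne x y) v⟫)
      (isClosed_eq (by fun_prop) (by fun_prop)) (fun A B => ?_) v w
    refine (lp.hasSum_inner _ _).unique ?_
    refine (hsum A.2 B.2 x y).congr_fun fun i => ?_
    simp only [ha, comp_apply, innerSL_apply_apply]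
    rw [RCLike.inner_apply, inner_conj_symm, mul_comm, ← hV i _ A.2, ← hV i _ B.2]
    rfl
  have hrank : ∀ x y v w,
      HasSum (fun i => ⟪V i w, x⟫ * ⟪y, V i v⟫) ⟪w, Φ (rankOne x y) v⟫ := fun x y v w => by
    rw [← hinner]
    refine (lp.hasSum_inner (a x w) (a y v)).congr_fun fun i => ?_
    simp only [ha, comp_apply, innerSL_apply_apply]
    rw [RCLike.inner_apply, inner_conj_symm, mul_comm]
  have hVsum : ∀ w, Summable fun i => ‖V i w‖ ^ 2 := fun w => by
    have h1 : Summable fun z : ι × ι => ‖⟪V z.2 w, b z.1⟫‖ ^ 2 := by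
      have h2 : ∀ j, HasSum (fun i => ‖⟪V i w, b j⟫‖ ^ 2)
          (⟪b j, Φst (rankOne w w) (b j)⟫).re := fun j => by
        rw [hnp.inner_predual]
        refine (Complex.hasSum_re (hrank (b j) (b j) w w)).congr_fun fun i => ?_
        rw [← norm_sq_inner_eq, Complex.ofReal_re]
      refine (summable_prod_of_nonneg fun _ => by positivity).2 ⟨fun j => (h2 j).summable, ?_⟩
      simp only [(h2 _).tsum_eq]
      simpa using (Complex.hasSum_re (hnp.hasSum_inner 1 w w)).summable
    have h3 : Summable fun z : ι × ι => ‖⟪V z.1 w, b z.2⟫‖ ^ 2 :=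
      (Equiv.prodComm ι ι).summable_iff.2 h1
    refine (summable_congr fun i => ?_).2 ((summable_prod_of_nonneg fun _ => sq_nonneg _).1 h3).2
    exact (hasSum_norm_sq_inner b (V i w)).tsum_eq.symm
  intro T v w
  obtain ⟨s, hs, hs'⟩ := hasSum_inner_swap b (hVsum w) (summable_sq_apply T (hVsum v))
    (d := fun j => ⟪b j, T (Φst (rankOne v w) (b j))⟫) fun j => by
      have := hrank (b j) (star T (b j)) v w
      rw [← hnp.inner_predual] at this
      simpa [star_eq_adjoint, adjoint_inner_left] using this
  rw [hs'.unique (hnp.hasSum_inner T v w)] at hs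
  simpa [star_eq_adjoint, adjoint_inner_right] using hs

end Kraus

section Consequences

variable {b : HilbertBasis ι ℂ H} {M : VonNeumannAlgebra H}
  {φ Φ Φst : (H →L[ℂ] H) →ₗ[ℂ] (H →L[ℂ] H)} {x0 : H}

/-- If `C_φ` is positive then so is `D_φ`. -/
theorem isPositive_predual_of_isPositive_map (hM : IsFactor M) (hsep : Separating M x0)
    (hmem : ∀ B ∈ M, φ B ∈ M) (hext : ExtendsTilde M φ Φ) (hnp : IsNormalPair b Φ Φst)
    (hC : (Φ (rankOne x0 x0)).IsPositive) : (Φst (rankOne x0 x0)).IsPositive := by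
  refine isPositive_of_inner_nonneg fun v => ?_
  refine hsep.denseRange_orbitMap.induction_on (p := fun v => 0 ≤ ⟪v, Φst (rankOne x0 x0) v⟫) v
    (isClosed_le (by fun_prop) (by fun_prop)) fun A => ?_
  change 0 ≤ ⟪A.1 x0, Φst (rankOne x0 x0) (A.1 x0)⟫
  have hA : rankOne (A.1 x0) (A.1 x0) = A.1 * rankOne x0 x0 * star A.1 := by
    ext z
    simp [rankOne, star_eq_adjoint, adjoint_inner_right]
  rw [hnp.inner_predual, hA, hext.map_mul_mul hM hmem hnp A.2 (star_mem A.2)]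
  simpa [star_eq_adjoint, adjoint_inner_left] using inner_nonneg_of_isPositive hC (star A.1 x0)

section Matrix

variable {κ : Type*} {V : κ → H →L[ℂ] H} {k : ℕ} {A B : Fin k → Fin k → H →L[ℂ] H}

theorem hasSum_matrix
    (h : ∀ i j v w, HasSum (fun n => ⟪w, (star (V n) * A i j * V n) v⟫) ⟪w, B i j v⟫)
    (v w : Fin k → H) :
    HasSum (fun n => ∑ i, ∑ j, ⟪V n (w i), A i j (V n (v j))⟫)
      (∑ i, ∑ j, ⟪w i, B i j (v j)⟫) :=
  hasSum_sum fun i _ => hasSum_sum fun j _ => (h i j (v j) (w i)).congr_fun fun n => by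
    simp [star_eq_adjoint, adjoint_inner_right]

theorem MatPos.of_hasSum (hA : MatPos A)
    (h : ∀ i j v w, HasSum (fun n => ⟪w, (star (V n) * A i j * V n) v⟫) ⟪w, B i j v⟫) :
    MatPos B := fun v => (hasSum_matrix h v v).nonneg fun n => hA fun i => V n (v i)

theorem matNormLe.of_hasSum (hA : matNormLe A 1) {c : ℝ} (hc : 0 ≤ c)
    (hV : ∀ v, ∀ F : Finset κ, ∑ n ∈ F, ‖V n v‖ ^ 2 ≤ c * ‖v‖ ^ 2)
    (h : ∀ i j v w, HasSum (fun n => ⟪w, (star (V n) * A i j * V n) v⟫) ⟪w, B i j v⟫) :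
    matNormLe B c := fun v w => by
  have hsum : ∀ (u : Fin k → H) (F : Finset κ),
      ∑ n ∈ F, √(∑ i, ‖V n (u i)‖ ^ 2) ^ 2 ≤ c * ∑ i, ‖u i‖ ^ 2 := fun u F => by
    simp only [Real.sq_sqrt (Finset.sum_nonneg fun i _ => sq_nonneg ‖V _ (u i)‖)]
    rw [Finset.sum_comm, Finset.mul_sum]
    exact Finset.sum_le_sum fun i _ => hV (u i) F
  refine le_of_tendsto (hasSum_matrix h v w).norm (.of_forall fun F => ?_)
  calc _ ≤ ∑ n ∈ F, ‖∑ i, ∑ j, ⟪V n (w i), A i j (V n (v j))⟫‖ := norm_sum_le _ _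
    _ ≤ ∑ n ∈ F, √(∑ i, ‖V n (v i)‖ ^ 2) * √(∑ i, ‖V n (w i)‖ ^ 2) :=
      Finset.sum_le_sum fun n _ => by simpa using hA (fun i => V n (v i)) fun i => V n (w i)
    _ ≤ √(∑ n ∈ F, √(∑ i, ‖V n (v i)‖ ^ 2) ^ 2) * √(∑ n ∈ F, √(∑ i, ‖V n (w i)‖ ^ 2) ^ 2) :=
      Real.sum_mul_le_sqrt_mul_sqrt _ _ _
    _ ≤ √(c * ∑ i, ‖v i‖ ^ 2) * √(c * ∑ i, ‖w i‖ ^ 2) := by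
      gcongr
      exacts [hsum v F, hsum w F]
    _ = c * √(∑ i, ‖v i‖ ^ 2) * √(∑ i, ‖w i‖ ^ 2) := by
      rw [Real.sqrt_mul hc, Real.sqrt_mul hc]
      linear_combination (√(∑ i, ‖v i‖ ^ 2) * √(∑ i, ‖w i‖ ^ 2)) * Real.mul_self_sqrt hc

end Matrix

section Kraus

variable {κ : Type*} {V : κ → H →L[ℂ] H}

/-- The partial sums of the Kraus coefficients are bounded by `φ 1`. -/
theorem sum_norm_sq_le (h : ∀ v w, HasSum (fun n => ⟪w, (star (V n) * 1 * V n) v⟫) ⟪w, φ 1 v⟫)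
    (v : H) (F : Finset κ) : ∑ n ∈ F, ‖V n v‖ ^ 2 ≤ ‖⟪v, φ 1 v⟫‖ := by
  have h1 : HasSum (fun n => ‖V n v‖ ^ 2) (⟪v, φ 1 v⟫).re :=
    (Complex.hasSum_re (h v v)).congr_fun fun n => by
      change _ = (⟪v, (star (V n) * 1) (V n v)⟫).re
      rw [mul_one, star_eq_adjoint, adjoint_inner_right]
      exact norm_sq_eq_re_inner (𝕜 := ℂ) _
  exact (sum_le_hasSum F (fun _ _ => by positivity) h1).trans (Complex.re_le_norm _)

theorem CBBoundOn.norm_inner_le {c : ℝ} (hc : CBBoundOn M φ c) (v : H) :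
    ‖⟪v, φ 1 v⟫‖ ≤ c * ‖v‖ ^ 2 := by
  have h := hc 1 (fun _ _ => 1) (fun _ _ => one_mem M)
    (fun v w => by simpa [mul_comm] using norm_inner_le_norm (w 0) (v 0)) (fun _ => v) fun _ => v
  simpa [mul_assoc, ← sq] using h

theorem cbBoundOn_of_kraus
    (h : ∀ B ∈ M, ∀ v w, HasSum (fun n => ⟪w, (star (V n) * B * V n) v⟫) ⟪w, φ B v⟫) :
    CBBoundOn M φ ‖φ 1‖ := fun k A hA hA1 =>
  hA1.of_hasSum (norm_nonneg _)
    (fun v F => (sum_norm_sq_le (h 1 (one_mem M)) v F).trans <| by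
      calc _ ≤ ‖v‖ * (‖φ 1‖ * ‖v‖) :=
            (norm_inner_le_norm _ _).trans (by gcongr; exact le_opNorm _ _)
        _ = _ := by ring)
    fun i j => h _ (hA i j)

/-- The Kraus coefficients of `φ` satisfy `∑ Vₙ* Vₙ ≤ ‖φ‖_cb`. -/
theorem isPositive_cbNormOn_sub
    (h : ∀ B ∈ M, ∀ v w, HasSum (fun n => ⟪w, (star (V n) * B * V n) v⟫) ⟪w, φ B v⟫)
    (F : Finset κ) :
    ((cbNormOn M φ : ℂ) • (1 : H →L[ℂ] H) - ∑ n ∈ F, star (V n) * V n).IsPositive := by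
  have hF : ∀ v, ∑ n ∈ F, ‖V n v‖ ^ 2 ≤ cbNormOn M φ * ‖v‖ ^ 2 := fun v => by
    rcases eq_or_ne v 0 with rfl | hv
    · simp
    rw [← div_le_iff₀ (by positivity)]
    refine le_csInf ⟨_, norm_nonneg _, cbBoundOn_of_kraus h⟩ fun c hc => ?_
    rw [div_le_iff₀ (by positivity)]
    exact (sum_norm_sq_le (h 1 (one_mem M)) v F).trans (hc.2.norm_inner_le v)
  refine isPositive_of_inner_nonneg fun v => ?_
  have : ⟪v, ((cbNormOn M φ : ℂ) • (1 : H →L[ℂ] H) - ∑ n ∈ F, star (V n) * V n) v⟫ =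
      ((cbNormOn M φ * ‖v‖ ^ 2 - ∑ n ∈ F, ‖V n v‖ ^ 2 : ℝ) : ℂ) := by
    simp [star_eq_adjoint, adjoint_inner_right, inner_self_eq_norm_sq_to_K]
  rw [this]
  exact_mod_cast sub_nonneg.2 (hF v)

end Kraus

theorem countable_of_hilbertBasis [TopologicalSpace.SeparableSpace H] (b : HilbertBasis ι ℂ H) :
    Countable ι := by
  refine Pairwise.countable_of_isOpen_disjoint (s := fun i => Metric.ball (b i) (1 / 2))
    (fun i j hij => Metric.ball_disjoint_ball ?_) (fun _ => Metric.isOpen_ball)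
    fun i => ⟨b i, Metric.mem_ball_self (by norm_num)⟩
  have h := norm_sub_sq (𝕜 := ℂ) (b i) (b j)
  rw [b.orthonormal.1, b.orthonormal.1, b.orthonormal.2 hij, map_zero] at h
  rw [dist_eq_norm]
  nlinarith [norm_nonneg (b i - b j)]

/-- A Kraus decomposition can be indexed by `ℕ`. -/
theorem exists_kraus_nat [TopologicalSpace.SeparableSpace H] (hM : IsFactor M)
    (hsep : Separating M x0) (hmem : ∀ B ∈ M, φ B ∈ M)
    (hext : ExtendsTilde M φ Φ) (hnp : IsNormalPair b Φ Φst)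
    (hD : (Φst (rankOne x0 x0)).IsPositive) :
    ∃ V : ℕ → H →L[ℂ] H, (∀ n, V n ∈ M) ∧
      ∀ T v w, HasSum (fun n => ⟪w, (star (V n) * T * V n) v⟫) ⟪w, Φ T v⟫ := by
  obtain ⟨V, hV, hsum⟩ := exists_kraus hM hsep hmem hext hnp hD
  have := countable_of_hilbertBasis b
  obtain ⟨f, hf⟩ := exists_injective_nat ι
  refine ⟨Function.extend f V 0, fun n => ?_, fun T v w => ?_⟩
  · by_cases hn : ∃ i, f i = n
    · obtain ⟨i, rfl⟩ := hn
      rw [hf.extend_apply]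
      exact hV i
    · rw [Function.extend_apply' _ _ _ hn]
      exact zero_mem M
  · refine (hf.hasSum_iff fun n hn => ?_).1 ((hsum T v w).congr_fun fun i => ?_)
    · rw [Function.extend_apply' _ _ _ hn]
      simp
    · simp [hf.extend_apply]

end Consequences

/-- Theorem 3.1.  For `φ ∈ CB^σ_ε(M)` (with normal extension
`Φ` of `φ̃` and predual map `Φst`), the following are equivalent:
(i) `φ` is completely positive; (ii) `φ̃` is completely positive;
(iii) `φ̃` is positive; (iv) `C_φ ≥ 0`; (v) `D_φ ≥ 0`;
(vi) `φ = Σᵢ Ad_{Vᵢ}` in the point-weak topology with `Vᵢ ∈ M` and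
`Σᵢ Vᵢ*Vᵢ ≤ ‖φ‖_cb · 1`. -/
theorem statement3
    {H : Type*} [NormedAddCommGroup H] [InnerProductSpace ℂ H] [CompleteSpace H]
    [TopologicalSpace.SeparableSpace H]
    {ι : Type*} (b : HilbertBasis ι ℂ H)
    (M : VonNeumannAlgebra H) (hfactor : IsFactor M)
    (x0 : H) (hx0 : ‖x0‖ = 1) (hcyc : Cyclic M x0) (hsep : Separating M x0)
    (φ Φ Φst : (H →L[ℂ] H) →ₗ[ℂ] (H →L[ℂ] H)) (hmem : ∀ B ∈ M, φ B ∈ M)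
    (hext : ExtendsTilde M φ Φ) (hnp : IsNormalPair b Φ Φst) :
    List.TFAE [IsCPOn M φ,
      IsCPFull Φ,
      ∀ T : H →L[ℂ] H, T.IsPositive → (Φ T).IsPositive,
      (Φ (rankOne x0 x0)).IsPositive,
      (Φst (rankOne x0 x0)).IsPositive,
      ∃ V : ℕ → (H →L[ℂ] H), (∀ n, V n ∈ M) ∧
        (∀ F : Finset ℕ,
          ((cbNormOn M φ : ℂ) • (1 : H →L[ℂ] H) - ∑ n ∈ F, star (V n) * V n).IsPositive) ∧
        ∀ B ∈ M, ∀ v w : H,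
          HasSum (fun n => ⟪w, (star (V n) * B * V n) v⟫) ⟪w, φ B v⟫] := by
  have hmap : ∀ B ∈ M, Φ B = φ B := fun B hB => by
    simpa using hext 1 (one_mem M.commutant) B hB
  tfae_have 1 → 3 := fun h T hT => h.isPositive_map hfactor hmem hext hnp hT
  tfae_have 3 → 4 := fun h => h _ <| isPositive_of_inner_nonneg fun v => by
    have : ⟪v, rankOne x0 x0 v⟫ = ((‖⟪x0, v⟫‖ ^ 2 : ℝ) : ℂ) := by
      rw [norm_sq_inner_eq]
      simp [rankOne]
    rw [this]
    exact_mod_cast sq_nonneg ‖⟪x0, v⟫‖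
  tfae_have 4 → 5 := isPositive_predual_of_isPositive_map hfactor hsep hmem hext hnp
  tfae_have 5 → 2 := fun h k A hA =>
    have ⟨_, _, hV⟩ := exists_kraus_nat hfactor hsep hmem hext hnp h
    hA.of_hasSum fun i j => hV (A i j)
  tfae_have 2 → 3 := fun h T hT => isPositive_of_inner_nonneg fun v => by
    simpa using h 1 (fun _ _ => T) (fun u => by simpa using inner_nonneg_of_isPositive hT (u 0))
      fun _ => v
  tfae_have 5 → 6 := fun h => by
    obtain ⟨V, hVM, hV⟩ := exists_kraus_nat hfactor hsep hmem hext hnp h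
    have hφ : ∀ B ∈ M, ∀ v w,
        HasSum (fun n => ⟪w, (star (V n) * B * V n) v⟫) ⟪w, φ B v⟫ := fun B hB v w =>
      hmap B hB ▸ hV B v w
    exact ⟨V, hVM, isPositive_cbNormOn_sub hφ, hφ⟩
  tfae_have 6 → 1 := fun ⟨_, _, _, hV⟩ k A hA hpos => hpos.of_hasSum fun i j => hV _ (hA i j)
  tfae_finish

end ChoiInf
end
end
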